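/- For f : ℝ³ → ℂ measurable, ‖f‖_{L¹(ℝ³)} ≲ ‖xf‖_{L²(ℝ³)}^{1/2} ‖x²f‖_{L²(ℝ³)}^{1/2}, where xf(x) = |x|f(x) and x²f(x) = |x|²f(x). -/

import Mathlib

open MeasureTheory

open Set
open scoped ENNReal

/-- The reciprocal weight `(‖x‖² + ‖x‖⁴)⁻¹` is integrable on `ℝ³`. -/
lemma integrable_inv_norm_sq_add_norm_pow_four :
    Integrable (fun x : EuclideanSpace ℝ (Fin 3) => (‖x‖ ^ 2 + ‖x‖ ^ 4)⁻¹) := by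
  rw [integrable_fun_norm_addHaar volume (f := fun r : ℝ => (r ^ 2 + r ^ 4)⁻¹)]
  refine integrable_inv_one_add_sq.integrableOn.congr_fun (fun r hr => ?_) measurableSet_Ioi
  have hr' : r ≠ 0 := (mem_Ioi.mp hr).ne'
  simp only [finrank_euclideanSpace, Fintype.card_fin, smul_eq_mul]
  field_simp

lemma inv_norm_sq_add_norm_pow_four_div_eq {R : ℝ} (hR : 0 < R)
    (x : EuclideanSpace ℝ (Fin 3)) :
    (‖x‖ ^ 2 + ‖x‖ ^ 4 / R ^ 2)⁻¹ =
      (R ^ 2)⁻¹ * (‖R⁻¹ • x‖ ^ 2 + ‖R⁻¹ • x‖ ^ 4)⁻¹ := by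
  rw [norm_smul, norm_inv, Real.norm_of_nonneg hR.le, ← mul_inv]
  congr 1
  field_simp

lemma lintegral_inv_norm_sq_add_norm_pow_four_div {R : ℝ} (hR : 0 < R) :
    ∫⁻ x : EuclideanSpace ℝ (Fin 3), ENNReal.ofReal (‖x‖ ^ 2 + ‖x‖ ^ 4 / R ^ 2)⁻¹ =
      ENNReal.ofReal
        (R * ∫ x : EuclideanSpace ℝ (Fin 3), (‖x‖ ^ 2 + ‖x‖ ^ 4)⁻¹) := by
  have hint : Integrable fun x : EuclideanSpace ℝ (Fin 3) =>
      (R ^ 2)⁻¹ * (‖R⁻¹ • x‖ ^ 2 + ‖R⁻¹ • x‖ ^ 4)⁻¹ :=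
    (integrable_inv_norm_sq_add_norm_pow_four.comp_smul (inv_ne_zero hR.ne')).const_mul _
  simp_rw [inv_norm_sq_add_norm_pow_four_div_eq hR]
  rw [← ofReal_integral_eq_lintegral_ofReal hint (.of_forall fun x => by positivity),
    integral_const_mul, Measure.integral_comp_inv_smul_of_nonneg volume
      (fun x : EuclideanSpace ℝ (Fin 3) => (‖x‖ ^ 2 + ‖x‖ ^ 4)⁻¹) hR.le]
  congr 1
  simp only [finrank_euclideanSpace, Fintype.card_fin, smul_eq_mul]
  field_simp

/-- Cauchy–Schwarz against a positive weight `w`. -/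
lemma lintegral_enorm_le_weighted {α E : Type*} [MeasurableSpace α] {μ : Measure α}
    [NormedAddCommGroup E] {f : α → E} (hf : AEStronglyMeasurable f μ) {w : α → ℝ}
    (hw : AEMeasurable w μ) (hpos : ∀ᵐ x ∂μ, 0 < w x) :
    ∫⁻ x, ‖f x‖ₑ ∂μ ≤
      (∫⁻ x, ENNReal.ofReal (w x)⁻¹ ∂μ) ^ ((1 : ℝ) / 2) *
        (∫⁻ x, ENNReal.ofReal (w x) * ‖f x‖ₑ ^ (2 : ℝ) ∂μ) ^ ((1 : ℝ) / 2) := by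
  have hsq (a : ℝ≥0∞) : (a ^ ((1 : ℝ) / 2)) ^ (2 : ℝ) = a := by
    rw [← ENNReal.rpow_mul]; norm_num
  have key := ENNReal.lintegral_mul_le_Lp_mul_Lq μ Real.HolderConjugate.two_two
    (f := fun x => ENNReal.ofReal (w x)⁻¹ ^ ((1 : ℝ) / 2))
    (g := fun x => ENNReal.ofReal (w x) ^ ((1 : ℝ) / 2) * ‖f x‖ₑ)
    (hw.inv.ennreal_ofReal.pow_const _) ((hw.ennreal_ofReal.pow_const _).mul hf.enorm)
  simp only [ENNReal.mul_rpow_of_nonneg _ _ zero_le_two, hsq] at key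
  refine le_trans (lintegral_mono_ae ?_) key
  filter_upwards [hpos] with x hx
  rw [Pi.mul_apply, ← mul_assoc, ← ENNReal.mul_rpow_of_nonneg _ _ (by norm_num),
    ← ENNReal.ofReal_mul (by positivity), inv_mul_cancel₀ hx.ne']
  simp

lemma eLpNorm_two_sq {α E : Type*} [MeasurableSpace α] {μ : Measure α}
    [NormedAddCommGroup E] (f : α → E) :
    eLpNorm f 2 μ ^ (2 : ℝ) = ∫⁻ x, ‖f x‖ₑ ^ (2 : ℝ) ∂μ := by
  simpa using eLpNorm_nnreal_pow_eq_lintegral (μ := μ) (f := f) (p := 2) two_ne_zero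

lemma eLpNorm_one_le_of_scale {f : EuclideanSpace ℝ (Fin 3) → ℂ} (hf : Measurable f)
    {R : ℝ} (hR : 0 < R) :
    eLpNorm f 1 volume ≤
      ENNReal.ofReal
          (R * ∫ x : EuclideanSpace ℝ (Fin 3), (‖x‖ ^ 2 + ‖x‖ ^ 4)⁻¹) ^ ((1 : ℝ) / 2) *
        (eLpNorm (fun x => (‖x‖ : ℂ) * f x) 2 volume ^ (2 : ℝ) +
          ENNReal.ofReal (R ^ 2)⁻¹ *
            eLpNorm (fun x => (‖x‖ : ℂ) ^ 2 * f x) 2 volume ^ (2 : ℝ)) ^ ((1 : ℝ) / 2) := by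
  have hpos : ∀ᵐ x : EuclideanSpace ℝ (Fin 3), 0 < ‖x‖ ^ 2 + ‖x‖ ^ 4 / R ^ 2 := by
    filter_upwards [Measure.ae_ne volume 0] with x hx
    have := norm_pos_iff.mpr hx
    positivity
  rw [eLpNorm_one_eq_lintegral_enorm, ← lintegral_inv_norm_sq_add_norm_pow_four_div hR]
  refine (lintegral_enorm_le_weighted hf.aestronglyMeasurable (by fun_prop) hpos).trans_eq ?_
  rw [eLpNorm_two_sq, eLpNorm_two_sq, ← lintegral_const_mul _ (by fun_prop),
    ← lintegral_add_left (by fun_prop)]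
  congr 2
  refine lintegral_congr fun x => ?_
  have hx : ‖(‖x‖ : ℂ)‖ₑ = ENNReal.ofReal ‖x‖ := by
    rw [← ofReal_norm]; simp
  rw [enorm_mul, enorm_mul, enorm_pow, hx, ENNReal.mul_rpow_of_nonneg _ _ zero_le_two,
    ENNReal.mul_rpow_of_nonneg _ _ zero_le_two, ← mul_assoc, ← add_mul]
  congr 1
  simp only [ENNReal.rpow_two]
  rw [← ENNReal.ofReal_pow (by positivity), ← ENNReal.ofReal_pow (by positivity),
    ← ENNReal.ofReal_mul (by positivity), ← ENNReal.ofReal_add (by positivity) (by positivity)]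
  congr 1
  ring

lemma ae_eq_zero_of_eLpNorm_norm_pow_mul_eq_zero {f : EuclideanSpace ℝ (Fin 3) → ℂ}
    (hf : Measurable f) (n : ℕ)
    (h : eLpNorm (fun x => (‖x‖ : ℂ) ^ n * f x) 2 volume = 0) : f =ᵐ[volume] 0 := by
  rw [eLpNorm_eq_zero_iff (by fun_prop) two_ne_zero] at h
  filter_upwards [h, Measure.ae_ne volume 0] with x hx hx0
  simpa [hx0] using hx

/-- Weighted interpolation inequality in `ℝ³`:
`‖f‖_{L¹} ≲ ‖xf‖_{L²}^{1/2} ‖x²f‖_{L²}^{1/2}`. -/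
theorem stmt_10 :
    ∃ C > 0, ∀ f : EuclideanSpace ℝ (Fin 3) → ℂ, Measurable f →
      eLpNorm f 1 volume ≤
        ENNReal.ofReal C *
          (eLpNorm (fun x : EuclideanSpace ℝ (Fin 3) => (‖x‖ : ℂ) * f x) 2 volume)
            ^ ((1 : ℝ) / 2) *
          (eLpNorm (fun x : EuclideanSpace ℝ (Fin 3) => (‖x‖ : ℂ) ^ 2 * f x) 2 volume)
            ^ ((1 : ℝ) / 2) := by
  set K : ℝ := ∫ x : EuclideanSpace ℝ (Fin 3), (‖x‖ ^ 2 + ‖x‖ ^ 4)⁻¹ with hK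
  have hK0 : 0 ≤ K := integral_nonneg fun x => by positivity
  refine ⟨(2 * K + 1) ^ ((1 : ℝ) / 2), by positivity, fun f hf => ?_⟩
  have hscale := fun R hR => eLpNorm_one_le_of_scale hf (R := R) hR
  have hzA := ae_eq_zero_of_eLpNorm_norm_pow_mul_eq_zero hf 1
  have hzB := ae_eq_zero_of_eLpNorm_norm_pow_mul_eq_zero hf 2
  simp only [pow_one] at hzA
  rw [← hK] at hscale
  set A := eLpNorm (fun x : EuclideanSpace ℝ (Fin 3) => (‖x‖ : ℂ) * f x) 2 volume
  set B := eLpNorm (fun x : EuclideanSpace ℝ (Fin 3) => (‖x‖ : ℂ) ^ 2 * f x) 2 volume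
  by_cases hf0 : f =ᵐ[volume] 0
  · simp [eLpNorm_congr_ae hf0]
  have hA : A ≠ 0 := mt hzA hf0
  have hB : B ≠ 0 := mt hzB hf0
  have hC : ENNReal.ofReal ((2 * K + 1) ^ ((1 : ℝ) / 2)) ≠ 0 := by
    simp only [ne_eq, ENNReal.ofReal_eq_zero, not_le]
    positivity
  rcases eq_or_ne A ∞ with hA' | hA'
  · rw [hA', ENNReal.top_rpow_of_pos (by norm_num), ENNReal.mul_top hC,
      ENNReal.top_mul (by simp [hB])]
    exact le_top
  rcases eq_or_ne B ∞ with hB' | hB'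
  · rw [hB', ENNReal.top_rpow_of_pos (by norm_num),
      ENNReal.mul_top (mul_ne_zero hC (by simp [hA]))]
    exact le_top
  obtain ⟨a, ha, hAa⟩ : ∃ a : ℝ, 0 < a ∧ A = ENNReal.ofReal a :=
    ⟨A.toReal, ENNReal.toReal_pos hA hA', (ENNReal.ofReal_toReal hA').symm⟩
  obtain ⟨b, hb, hBb⟩ : ∃ b : ℝ, 0 < b ∧ B = ENNReal.ofReal b :=
    ⟨B.toReal, ENNReal.toReal_pos hB hB', (ENNReal.ofReal_toReal hB').symm⟩
  refine (hscale (b / a) (by positivity)).trans ?_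
  rw [hAa, hBb, ← ENNReal.ofReal_rpow_of_nonneg (by positivity) (by norm_num),
    ← ENNReal.mul_rpow_of_nonneg _ _ (by norm_num), ← ENNReal.mul_rpow_of_nonneg _ _ (by norm_num),
    ← ENNReal.mul_rpow_of_nonneg _ _ (by norm_num)]
  refine ENNReal.rpow_le_rpow ?_ (by norm_num)
  simp only [ENNReal.rpow_two]
  rw [← ENNReal.ofReal_pow ha.le, ← ENNReal.ofReal_pow hb.le,
    ← ENNReal.ofReal_mul (by positivity), ← ENNReal.ofReal_add (by positivity) (by positivity),
    ← ENNReal.ofReal_mul (by positivity), ← ENNReal.ofReal_mul (by positivity),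
    ← ENNReal.ofReal_mul (by positivity)]
  refine ENNReal.ofReal_le_ofReal ?_
  have hab : 0 < a * b := by positivity
  have heq : b / a * K * (a ^ 2 + ((b / a) ^ 2)⁻¹ * b ^ 2) = 2 * K * (a * b) := by
    field_simp
    ring
  rw [heq]
  linarith
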